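/- arXiv:2204.08333 — 3 statements merged into one kernel-verified Lean document; each statement's English description precedes it below -/
import Mathlib

section
/- Method of continuation: Let (X, ‖·‖_X) be a real Banach space, (Y, ‖·‖_Y) a real normed space, and T : Y → X a continuous map. Suppose F : X → Y satisfies: (Lipschitz continuity) there exists L > 0 such that ‖F(x₁) − F(x₂)‖_Y ≤ L‖x₁ − x₂‖_X for all x₁, x₂ ∈ X; and (a priori estimate) there exists K > 0 such that for any φ₁, φ₂ ∈ Y and any λ ∈ [0,1], if x₁, x₂ ∈ X satisfy xᵢ = T(λ F(xᵢ) + φᵢ) for i = 1, 2, then ‖x₁ − x₂‖_X ≤ K‖φ₁ − φ₂‖_Y. Then for every φ ∈ Y there exists a unique x ∈ X solving the equation x = T(F(x) + φ). -/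
/-- Banach's fixed point theorem for an equation `x = G (ε • F x + φ)` with `G` and `F` Lipschitz
and `ε` small. -/
theorem exists_eq_apply_smul_add_of_lipschitz
    {X Y : Type*} [NormedAddCommGroup X] [CompleteSpace X]
    [NormedAddCommGroup Y] [NormedSpace ℝ Y] {F : X → Y} {G : Y → X} {L K ε : ℝ}
    (hK : 0 ≤ K) (hε : 0 ≤ ε)
    (hF : ∀ x₁ x₂ : X, ‖F x₁ - F x₂‖ ≤ L * ‖x₁ - x₂‖)
    (hG : ∀ y₁ y₂ : Y, ‖G y₁ - G y₂‖ ≤ K * ‖y₁ - y₂‖)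
    (hsmall : K * ε * L < 1) (φ : Y) :
    ∃ x : X, x = G (ε • F x + φ) := by
  have hcontr : ContractingWith (K * ε * L).toNNReal (fun x => G (ε • F x + φ)) := by
    refine ⟨by simpa using hsmall, LipschitzWith.of_dist_le_mul fun x₁ x₂ => ?_⟩
    rw [dist_eq_norm, dist_eq_norm]
    calc ‖G (ε • F x₁ + φ) - G (ε • F x₂ + φ)‖
        ≤ K * ‖(ε • F x₁ + φ) - (ε • F x₂ + φ)‖ := hG _ _
      _ = K * (ε * ‖F x₁ - F x₂‖) := by
          rw [add_sub_add_right_eq_sub, ← smul_sub, norm_smul, Real.norm_of_nonneg hε]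
      _ ≤ K * (ε * (L * ‖x₁ - x₂‖)) := by gcongr; exact hF _ _
      _ = K * ε * L * ‖x₁ - x₂‖ := by ring
      _ ≤ (K * ε * L).toNNReal * ‖x₁ - x₂‖ := by gcongr; exact Real.le_coe_toNNReal _
  exact ⟨_, hcontr.fixedPoint_isFixedPt.symm⟩

/-- **Method of continuation.** Let `X` be a real Banach space, `Y` a real normed space,
`T : Y → X` continuous.  Suppose `F : X → Y` is Lipschitz continuous with constant `L > 0`,
and satisfies the a priori estimate: there is `K > 0` such that for any `φ₁, φ₂ ∈ Y` and any
`λ ∈ [0,1]`, solutions `x₁, x₂` of `xᵢ = T (λ • F xᵢ + φᵢ)` satisfy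
`‖x₁ - x₂‖ ≤ K ‖φ₁ - φ₂‖`.  Then for every `φ ∈ Y` there is a unique `x ∈ X` with
`x = T (F x + φ)`. -/
theorem method_of_continuation
    {X Y : Type*} [NormedAddCommGroup X] [NormedSpace ℝ X] [CompleteSpace X]
    [NormedAddCommGroup Y] [NormedSpace ℝ Y]
    (T : Y → X) (hT : Continuous T) (F : X → Y)
    (L : ℝ) (hLpos : 0 < L)
    (hLip : ∀ x₁ x₂ : X, ‖F x₁ - F x₂‖ ≤ L * ‖x₁ - x₂‖)
    (K : ℝ) (hKpos : 0 < K)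
    (hapriori : ∀ φ₁ φ₂ : Y, ∀ lam ∈ Set.Icc (0 : ℝ) 1, ∀ x₁ x₂ : X,
      x₁ = T (lam • F x₁ + φ₁) → x₂ = T (lam • F x₂ + φ₂) →
      ‖x₁ - x₂‖ ≤ K * ‖φ₁ - φ₂‖) :
    ∀ φ : Y, ∃! x : X, x = T (F x + φ) := by
  have hstep : ∀ lam ∈ Set.Icc (0 : ℝ) 1, ∀ ε : ℝ, 0 ≤ ε → K * ε * L < 1 →
      (∀ φ : Y, ∃ x : X, x = T (lam • F x + φ)) →
      ∀ φ : Y, ∃ x : X, x = T ((lam + ε) • F x + φ) := by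
    intro lam hlam ε hε hsmall hsolv φ
    choose G hG using hsolv
    obtain ⟨x, hx⟩ := exists_eq_apply_smul_add_of_lipschitz hKpos.le hε hLip
      (fun y₁ y₂ => hapriori y₁ y₂ lam hlam _ _ (hG y₁) (hG y₂)) hsmall φ
    refine ⟨x, ?_⟩
    have h := hG (ε • F x + φ)
    rwa [← hx, ← add_assoc, ← add_smul] at h
  obtain ⟨n, hn⟩ := exists_nat_gt (K * L)
  have hn0 : (0 : ℝ) < n := (mul_pos hKpos hLpos).trans hn
  have hsmall : K * (1 / n : ℝ) * L < 1 := by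
    rw [mul_right_comm, mul_one_div, div_lt_one hn0]
    exact hn
  have hsolv : ∀ k : ℕ, k ≤ n → ∀ φ : Y, ∃ x : X, x = T ((k / n : ℝ) • F x + φ) := by
    intro k
    induction k with
    | zero => exact fun _ φ => ⟨T φ, by simp⟩
    | succ k ih =>
      intro hk
      have hk' : (k : ℝ) ≤ n := by exact_mod_cast (Nat.le_succ k).trans hk
      have h := hstep (k / n) ⟨by positivity, div_le_one_of_le₀ hk' hn0.le⟩ (1 / n)
        (by positivity) hsmall (ih ((Nat.le_succ k).trans hk))
      rwa [← add_div, ← Nat.cast_succ] at h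
  intro φ
  obtain ⟨x, hx⟩ := hsolv n le_rfl φ
  rw [div_self hn0.ne', one_smul] at hx
  refine ⟨x, hx, fun z hz => ?_⟩
  have h := hapriori φ φ 1 (by simp) z x (by simpa using hz) (by simpa using hx)
  rw [sub_self, norm_zero, mul_zero] at h
  exact sub_eq_zero.mp (norm_le_zero_iff.mp h)
end

section
/- Let T > 0 and d ∈ ℕ. Let P₁ : (0,T) → ℝ^{d×d} be measurable and essentially bounded with P₁(t) symmetric a.e., and let P₂ ∈ L²((0,T)²; ℝ^{d×d}). If ∫₀^T ⟨P₁(t)x(t), x(t)⟩ dt + ∫₀^T ∫₀^T ⟨P₂(s₁,s₂)x(s₂), x(s₁)⟩ ds₁ ds₂ = 0 for every x ∈ L²((0,T); ℝ^d), then P₁(t) = 0 for a.e. t ∈ (0,T). -/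
open MeasureTheory Set Matrix

attribute [local instance] Matrix.frobeniusSeminormedAddCommGroup
  Matrix.frobeniusNormedAddCommGroup Matrix.frobeniusNormedSpace

instance (m n : ℕ) : MeasurableSpace (Matrix (Fin m) (Fin n) ℝ) :=
  inferInstanceAs (MeasurableSpace (Fin m → Fin n → ℝ))

theorem Matrix.frobenius_norm_apply_le {m n : ℕ} (A : Matrix (Fin m) (Fin n) ℝ)
    (i : Fin m) (j : Fin n) : |A i j| ≤ ‖A‖ :=
  (PiLp.norm_apply_le (WithLp.toLp 2 (A i)) j).trans
    (PiLp.norm_apply_le (WithLp.toLp 2 fun k => WithLp.toLp 2 (A k)) i)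

theorem Matrix.measurable_apply_apply {m n : ℕ} (i : Fin m) (j : Fin n) :
    Measurable fun A : Matrix (Fin m) (Fin n) ℝ => A i j :=
  (measurable_pi_apply j).comp (measurable_pi_apply (X := fun _ : Fin m => Fin n → ℝ) i)

theorem eventually_floor_nat_mul_ne {s t : ℝ} (h : s ≠ t) :
    ∀ᶠ n : ℕ in Filter.atTop, ⌊(n : ℝ) * s⌋ ≠ ⌊(n : ℝ) * t⌋ := by
  obtain ⟨N, hN⟩ := exists_nat_gt (1 / |s - t|)
  have hst : 0 < |s - t| := abs_pos.mpr (sub_ne_zero.mpr h)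
  filter_upwards [Filter.eventually_ge_atTop N] with n hn heq
  have h1 := Int.abs_sub_lt_one_of_floor_eq_floor heq
  rw [← mul_sub, abs_mul, Nat.abs_cast] at h1
  rw [div_lt_iff₀ hst] at hN
  have : (N : ℝ) ≤ n := by exact_mod_cast hn
  nlinarith

/-- A density `f` on the diagonal cannot be compensated by an integrable kernel `g`: cut a set
into pieces of length `1 / n` and let `n` tend to infinity. -/
theorem ae_eq_zero_of_setIntegral_add_setIntegral_prod_eq_zero
    {μ : Measure ℝ} [SFinite μ] [NullSingletonClass μ] {f : ℝ → ℝ} {g : ℝ × ℝ → ℝ}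
    (hf : Integrable f μ) (hg : Integrable g (μ.prod μ))
    (h : ∀ E : Set ℝ, MeasurableSet E →
      (∫ t in E, f t ∂μ) + ∫ p in E ×ˢ E, g p ∂(μ.prod μ) = 0) :
    f =ᵐ[μ] 0 := by
  refine hf.ae_eq_zero_of_forall_setIntegral_eq_zero fun E hE _ => ?_
  set D : ℕ → Set (ℝ × ℝ) := fun n =>
    (E ×ˢ E) ∩ {p | ⌊(n : ℝ) * p.1⌋ = ⌊(n : ℝ) * p.2⌋} with hD
  have hDm (n : ℕ) : MeasurableSet (D n) :=
    (hE.prod hE).inter (measurableSet_eq_fun (by fun_prop) (by fun_prop))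
  have hpieces (n : ℕ) : ∫ p in D n, g p ∂(μ.prod μ) = -∫ t in E, f t ∂μ := by
    set A : ℤ → Set ℝ := fun k => E ∩ {t | ⌊(n : ℝ) * t⌋ = k} with hA
    have hAm (k : ℤ) : MeasurableSet (A k) :=
      hE.inter (measurableSet_eq_fun (by fun_prop) measurable_const)
    have hAd : Pairwise (Function.onFun Disjoint A) := fun j k hjk =>
      Set.disjoint_left.mpr fun t hj hk => hjk (hj.2.symm.trans hk.2)
    have hAAd : Pairwise (Function.onFun Disjoint fun k => A k ×ˢ A k) := fun j k hjk =>
      Set.disjoint_left.mpr fun p hj hk => hjk (hj.1.2.symm.trans hk.1.2)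
    have hAU : ⋃ k, A k = E := by ext t; simp [hA]
    have hAAU : ⋃ k, A k ×ˢ A k = D n := by
      ext p
      simp only [hA, hD, mem_iUnion, mem_prod, mem_inter_iff, mem_ofPred_eq]
      grind
    have h1 := hasSum_integral_iUnion hAm hAd (hf.integrableOn (s := ⋃ k, A k))
    have h2 := hasSum_integral_iUnion (fun k => (hAm k).prod (hAm k)) hAAd
      (hg.integrableOn (s := ⋃ k, A k ×ˢ A k))
    rw [hAU] at h1
    rw [hAAU] at h2
    have h3 := h1.add h2
    simp only [h _ (hAm _)] at h3
    linarith [h3.unique hasSum_zero]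
  have hdiag : ∀ᵐ p ∂(μ.prod μ), p.1 ≠ p.2 := by
    refine (Measure.ae_prod_iff_ae_ae (p := fun p : ℝ × ℝ => p.1 ≠ p.2)
      (measurableSet_eq_fun measurable_fst measurable_snd).compl).mpr
      (Filter.Eventually.of_forall fun s => ?_)
    filter_upwards [compl_mem_ae_iff.mpr (measure_singleton (μ := μ) s)] with t ht
    exact Ne.symm ht
  have hlim : Filter.Tendsto (fun n => ∫ p, (D n).indicator g p ∂(μ.prod μ)) Filter.atTop
      (nhds (∫ _, (0 : ℝ) ∂(μ.prod μ))) := by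
    refine tendsto_integral_of_dominated_convergence (fun p => ‖g p‖)
      (fun n => hg.aestronglyMeasurable.indicator (hDm n)) hg.norm
      (fun n => Filter.Eventually.of_forall fun p => norm_indicator_le_norm_self _ _) ?_
    filter_upwards [hdiag] with p hp
    refine tendsto_const_nhds.congr' ?_
    filter_upwards [eventually_floor_nat_mul_ne hp] with n hn
    exact (indicator_of_notMem (fun hmem => hn hmem.2) _).symm
  simp only [integral_indicator (hDm _), hpieces, integral_zero] at hlim
  linarith [tendsto_nhds_unique hlim tendsto_const_nhds]

theorem Matrix.eq_zero_of_transpose_eq_of_mulVec_dotProduct_eq_zero {d : ℕ}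
    {A : Matrix (Fin d) (Fin d) ℝ} (hA : Aᵀ = A)
    (h : ∀ i j, (A *ᵥ (Pi.single i 1 + Pi.single j 1)) ⬝ᵥ (Pi.single i 1 + Pi.single j 1) = 0) :
    A = 0 := by
  ext i j
  have hij := h i j
  have hii := h i i
  have hjj := h j j
  have hsym : A j i = A i j := congrFun (congrFun hA i) j
  simp only [mulVec_add, dotProduct_add, mulVec_single_one,
    dotProduct_single_one, Pi.add_apply, col_apply] at hij hii hjj
  rw [zero_apply]
  linarith

theorem MeasureTheory.integrable_mulVec_dotProduct {α : Type*} [MeasurableSpace α]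
    {μ : Measure α} {d : ℕ} {P : α → Matrix (Fin d) (Fin d) ℝ}
    (hP : ∀ i j, Integrable (fun a => P a i j) μ) (y : Fin d → ℝ) :
    Integrable (fun a => (P a *ᵥ y) ⬝ᵥ y) μ := by
  simp only [dotProduct, mulVec]
  exact integrable_finsetSum _ fun i _ =>
    (integrable_finsetSum _ fun j _ => (hP i j).mul_const _).mul_const _

/-- If the quadratic functional
`∫₀^T ⟨P₁(t)x(t), x(t)⟩ dt + ∫₀^T ∫₀^T ⟨P₂(s₁,s₂)x(s₂), x(s₁)⟩ ds₁ ds₂`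
vanishes for every `x ∈ L²((0,T); ℝ^d)`, where `P₁` is essentially bounded with symmetric
values a.e. and `P₂` is square integrable, then `P₁(t) = 0` for a.e. `t ∈ (0,T)`. -/
theorem P1_vanishes_of_quadratic_eq_zero
    {d : ℕ} (T : ℝ) (hT : 0 < T)
    (P₁ : ℝ → Matrix (Fin d) (Fin d) ℝ) (hP₁m : Measurable P₁)
    (hP₁bdd : ∃ C, ∀ᵐ t ∂(volume.restrict (Set.Ioo 0 T)), ‖P₁ t‖ ≤ C)
    (hP₁sym : ∀ᵐ t ∂(volume.restrict (Set.Ioo 0 T)), (P₁ t)ᵀ = P₁ t)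
    (P₂ : ℝ → ℝ → Matrix (Fin d) (Fin d) ℝ)
    (hP₂m : Measurable fun p : ℝ × ℝ => P₂ p.1 p.2)
    (hP₂L2 : MeasureTheory.IntegrableOn (fun p : ℝ × ℝ => ‖P₂ p.1 p.2‖ ^ 2)
      ((Set.Ioo 0 T) ×ˢ (Set.Ioo 0 T)))
    (hQuad : ∀ x : ℝ → Fin d → ℝ,
      AEMeasurable x (volume.restrict (Set.Ioo 0 T)) →
      MeasureTheory.IntegrableOn (fun t => ∑ i, (x t i) ^ 2) (Set.Ioo 0 T) →
      (∫ t in Set.Ioo 0 T, ((P₁ t).mulVec (x t)) ⬝ᵥ (x t)) +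
        (∫ p in (Set.Ioo 0 T) ×ˢ (Set.Ioo 0 T),
          ((P₂ p.1 p.2).mulVec (x p.2)) ⬝ᵥ (x p.1)) = 0) :
    ∀ᵐ t ∂(volume.restrict (Set.Ioo 0 T)), P₁ t = 0 := by
  set μ := (volume : Measure ℝ).restrict (Ioo 0 T) with hμ
  have hprod : (volume : Measure (ℝ × ℝ)).restrict (Ioo 0 T ×ˢ Ioo 0 T) = μ.prod μ := by
    rw [hμ, Measure.prod_restrict, Measure.volume_eq_prod]
  rw [IntegrableOn, hprod] at hP₂L2
  obtain ⟨C, hC⟩ := hP₁bdd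
  have hP₁int (i j : Fin d) : Integrable (fun t => P₁ t i j) μ := by
    refine (integrable_const C).mono'
      ((measurable_apply_apply i j).comp hP₁m).aestronglyMeasurable ?_
    filter_upwards [hC] with t ht
    exact (frobenius_norm_apply_le _ i j).trans ht
  have hP₂int (i j : Fin d) : Integrable (fun p : ℝ × ℝ => P₂ p.1 p.2 i j) (μ.prod μ) := by
    refine ((integrable_const 1).add hP₂L2).mono'
      ((measurable_apply_apply i j).comp hP₂m).aestronglyMeasurable
      (Filter.Eventually.of_forall fun p => ?_)
    have := frobenius_norm_apply_le (P₂ p.1 p.2) i j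
    simp only [Real.norm_eq_abs, Pi.add_apply]
    nlinarith [sq_nonneg (‖P₂ p.1 p.2‖ - 1)]
  have hzero (y : Fin d → ℝ) : (fun t => (P₁ t *ᵥ y) ⬝ᵥ y) =ᵐ[μ] 0 := by
    refine ae_eq_zero_of_setIntegral_add_setIntegral_prod_eq_zero
      (integrable_mulVec_dotProduct hP₁int y)
      (integrable_mulVec_dotProduct (P := fun p : ℝ × ℝ => P₂ p.1 p.2) hP₂int y) fun E hE => ?_
    have hx := hQuad (E.indicator fun _ => y) (measurable_const.indicator hE).aemeasurable ?_
    · rw [hprod] at hx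
      rw [← integral_indicator hE, ← integral_indicator (hE.prod hE), ← hx]
      congr 2
      · ext t
        by_cases ht : t ∈ E <;> simp [ht]
      · ext p
        by_cases h1 : p.1 ∈ E <;> by_cases h2 : p.2 ∈ E <;> simp [h1, h2]
    · have : (fun t => ∑ i, (E.indicator (fun _ => y) t i) ^ 2) =
          E.indicator fun _ => ∑ i, y i ^ 2 := by
        ext t
        by_cases ht : t ∈ E <;> simp [ht]
      rw [this]
      exact (integrable_const _).indicator hE
  have hall : ∀ᵐ t ∂μ, ∀ i j : Fin d,
      (P₁ t *ᵥ (Pi.single i 1 + Pi.single j 1)) ⬝ᵥ (Pi.single i 1 + Pi.single j 1) = 0 :=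
    ae_all_iff.mpr fun i => ae_all_iff.mpr fun j => hzero _
  filter_upwards [hall, hP₁sym] with t ht hsym
  exact eq_zero_of_transpose_eq_of_mulVec_dotProduct_eq_zero hsym ht
end

section
/- The space sL²(△₂(0,T); ℝ^{d₁×d₂}), equipped with the norm ‖f‖_{sL²(△₂(0,T))} := ess sup_{t∈(0,T)} (∫_t^T |f(s,t)|² ds)^{1/2}, is a Banach space: it is a linear subspace of L²(△₂(0,T); ℝ^{d₁×d₂}) closed under addition and scalar multiplication, ‖·‖_{sL²} is a norm on it (identifying functions equal almost everywhere), and every Cauchy sequence in this norm converges to an element of sL²(△₂(0,T); ℝ^{d₁×d₂}). -/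
open MeasureTheory Set Matrix

attribute [local instance] Matrix.frobeniusSeminormedAddCommGroup
  Matrix.frobeniusNormedAddCommGroup Matrix.frobeniusNormedSpace

/-- The open triangle `△₂(0,T) = {(t,s) : 0 < s < t < T}` (first coordinate larger). -/
def tri (T : ℝ) : Set (ℝ × ℝ) := {p : ℝ × ℝ | 0 < p.2 ∧ p.2 < p.1 ∧ p.1 < T}

/-- The `sL²(△₂(0,T))` norm: `ess sup_{t ∈ (0,T)} (∫_t^T |f(s,t)|² ds)^{1/2}`. -/
noncomputable def sl2norm (T : ℝ) {d₁ d₂ : ℕ}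
    (f : ℝ → ℝ → Matrix (Fin d₁) (Fin d₂) ℝ) : ℝ :=
  essSup (fun t => Real.sqrt (∫ s in Set.Ioo t T, ‖f s t‖ ^ 2))
    (volume.restrict (Set.Ioo 0 T))

/-- Membership in `sL²(△₂(0,T); ℝ^{d₁×d₂})`: measurability, square integrability on the
triangle, essential boundedness of `t ↦ (∫_t^T |f(s,t)|² ds)^{1/2}`, and the partition
property: for every `ε > 0` there is a finite partition `0 = U₀ < ⋯ < U_m = T` with
`ess sup_{t ∈ (Uᵢ, Uᵢ₊₁)} (∫_t^{Uᵢ₊₁} |f(s,t)|² ds)^{1/2} < ε` for each `i`. -/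
def MemSL2 (T : ℝ) {d₁ d₂ : ℕ} (f : ℝ → ℝ → Matrix (Fin d₁) (Fin d₂) ℝ) : Prop :=
  (Measurable fun p : ℝ × ℝ => f p.1 p.2) ∧
    MeasureTheory.IntegrableOn (fun p : ℝ × ℝ => ‖f p.1 p.2‖ ^ 2) (tri T) ∧
    (∃ C, ∀ᵐ t ∂(volume.restrict (Set.Ioo 0 T)),
      Real.sqrt (∫ s in Set.Ioo t T, ‖f s t‖ ^ 2) ≤ C) ∧
    (∀ ε > 0, ∃ (m : ℕ) (U : ℕ → ℝ), U 0 = 0 ∧ U m = T ∧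
      (∀ i < m, U i < U (i + 1)) ∧
      ∀ i < m, ∃ c < ε, ∀ᵐ t ∂(volume.restrict (Set.Ioo (U i) (U (i + 1)))),
        Real.sqrt (∫ s in Set.Ioo t (U (i + 1)), ‖f s t‖ ^ 2) ≤ c)

open Filter Topology
open scoped ENNReal

section
variable {E : Type*} [NormedAddCommGroup E]

/-- The `L²` norm of the slice `s ↦ f s t` over `(t, b)`, as an extended nonnegative real. -/
noncomputable def sliceNorm (f : ℝ → ℝ → E) (b t : ℝ) : ℝ≥0∞ :=
  eLpNorm (fun s => f s t) 2 (volume.restrict (Ioo t b))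

theorem sliceNorm_mono (f : ℝ → ℝ → E) {b b' : ℝ} (h : b ≤ b') (t : ℝ) :
    sliceNorm f b t ≤ sliceNorm f b' t :=
  eLpNorm_mono_measure _ (Measure.restrict_mono (Ioo_subset_Ioo_right h) le_rfl)

theorem sliceNorm_sq (f : ℝ → ℝ → E) (b t : ℝ) :
    sliceNorm f b t ^ 2 = ∫⁻ s in Ioo t b, ‖f s t‖ₑ ^ 2 := by
  have := eLpNorm_nnreal_pow_eq_lintegral (f := fun s => f s t)
    (μ := volume.restrict (Ioo t b)) (p := 2) two_ne_zero
  simpa [sliceNorm] using this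

theorem sliceNorm_const_smul [NormedSpace ℝ E] (c : ℝ) (f : ℝ → ℝ → E) (b t : ℝ) :
    sliceNorm (fun s t => c • f s t) b t = ‖c‖ₑ * sliceNorm f b t :=
  eLpNorm_const_smul c (fun s => f s t) _ _

theorem measurableSet_tri (T : ℝ) : MeasurableSet (tri T) :=
  (measurableSet_lt measurable_const measurable_snd).inter
    ((measurableSet_lt measurable_snd measurable_fst).inter
      (measurableSet_lt measurable_fst measurable_const))

theorem lintegral_tri (T : ℝ) {h : ℝ × ℝ → ℝ≥0∞} (hh : Measurable h) :
    ∫⁻ p in tri T, h p = ∫⁻ t in Ioo 0 T, ∫⁻ s in Ioo t T, h (s, t) := by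
  rw [← lintegral_indicator (measurableSet_tri T), Measure.volume_eq_prod,
    lintegral_prod_symm _ (hh.indicator (measurableSet_tri T)).aemeasurable,
    ← lintegral_indicator measurableSet_Ioo]
  refine lintegral_congr fun t => ?_
  by_cases ht : t ∈ Ioo 0 T
  · rw [indicator_of_mem ht, ← lintegral_indicator measurableSet_Ioo]
    refine lintegral_congr fun s => ?_
    have : (s, t) ∈ tri T ↔ s ∈ Ioo t T := by simp [tri, ht.1]
    by_cases hs : s ∈ Ioo t T
    · rw [indicator_of_mem hs, indicator_of_mem (this.2 hs)]
    · rw [indicator_of_notMem hs, indicator_of_notMem (mt this.1 hs)]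
  · rw [indicator_of_notMem ht, ← lintegral_zero]
    refine lintegral_congr fun s => indicator_of_notMem (fun hs => ht ?_) _
    exact ⟨hs.1, hs.2.1.trans hs.2.2⟩

theorem measurable_lintegral_slice (T : ℝ) {h : ℝ × ℝ → ℝ≥0∞} (hh : Measurable h) :
    Measurable fun t => ∫⁻ s in Ioo t T, h (s, t) := by
  have hS : MeasurableSet {p : ℝ × ℝ | p.2 ∈ Ioo p.1 T} :=
    (measurableSet_lt measurable_fst measurable_snd).inter
      (measurableSet_lt measurable_snd measurable_const)
  have hm : Measurable ({p : ℝ × ℝ | p.2 ∈ Ioo p.1 T}.indicator fun p => h (p.2, p.1)) :=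
    (hh.comp measurable_swap).indicator hS
  convert hm.lintegral_prod_right' (ν := volume) using 2 with t
  rw [← lintegral_indicator measurableSet_Ioo]
  rfl

variable [MeasurableSpace E] [BorelSpace E]

theorem measurable_enorm_sq {f : ℝ → ℝ → E} (hf : Measurable fun p : ℝ × ℝ => f p.1 p.2) :
    Measurable fun p : ℝ × ℝ => ‖f p.1 p.2‖ₑ ^ 2 :=
  hf.enorm.pow_const 2

theorem lintegral_tri_enorm_sq (T : ℝ) {f : ℝ → ℝ → E}
    (hf : Measurable fun p : ℝ × ℝ => f p.1 p.2) :
    ∫⁻ p in tri T, ‖f p.1 p.2‖ₑ ^ 2 = ∫⁻ t in Ioo 0 T, sliceNorm f T t ^ 2 := by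
  simp_rw [lintegral_tri T (measurable_enorm_sq hf), sliceNorm_sq]

theorem measurable_sliceNorm_sq (T : ℝ) {f : ℝ → ℝ → E}
    (hf : Measurable fun p : ℝ × ℝ => f p.1 p.2) : Measurable fun t => sliceNorm f T t ^ 2 := by
  simp_rw [sliceNorm_sq]
  exact measurable_lintegral_slice T (measurable_enorm_sq hf)

theorem ae_tri_eq_zero_iff (T : ℝ) {f : ℝ → ℝ → E}
    (hf : Measurable fun p : ℝ × ℝ => f p.1 p.2) :
    (∀ᵐ p ∂(volume.restrict (tri T)), f p.1 p.2 = 0) ↔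
      ∀ᵐ t ∂(volume.restrict (Ioo 0 T)), sliceNorm f T t = 0 := by
  have h := lintegral_tri_enorm_sq T hf
  have h₁ := lintegral_eq_zero_iff (μ := volume.restrict (tri T)) (measurable_enorm_sq hf)
  have h₂ := lintegral_eq_zero_iff (μ := volume.restrict (Ioo 0 T))
    (measurable_sliceNorm_sq T hf)
  rw [h, h₂] at h₁
  simpa [EventuallyEq] using h₁.symm

theorem integrableOn_tri_iff (T : ℝ) {f : ℝ → ℝ → E}
    (hf : Measurable fun p : ℝ × ℝ => f p.1 p.2) :
    IntegrableOn (fun p : ℝ × ℝ => ‖f p.1 p.2‖ ^ 2) (tri T) ↔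
      ∫⁻ t in Ioo 0 T, sliceNorm f T t ^ 2 < ∞ := by
  have hm : AEStronglyMeasurable (fun p : ℝ × ℝ => ‖f p.1 p.2‖ ^ 2) (volume.restrict (tri T)) :=
    (hf.norm.pow_const 2).aestronglyMeasurable
  rw [← lintegral_tri_enorm_sq T hf, IntegrableOn, Integrable, hasFiniteIntegral_iff_enorm,
    and_iff_right hm]
  simp

theorem ae_sliceNorm_lt_top {T : ℝ} {f : ℝ → ℝ → E}
    (hf : Measurable fun p : ℝ × ℝ => f p.1 p.2)
    (h : IntegrableOn (fun p : ℝ × ℝ => ‖f p.1 p.2‖ ^ 2) (tri T)) :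
    ∀ᵐ t ∂(volume.restrict (Ioo 0 T)), sliceNorm f T t < ∞ := by
  rw [integrableOn_tri_iff T hf] at h
  filter_upwards [ae_lt_top (measurable_sliceNorm_sq T hf) h.ne] with t ht
  simpa using ht

theorem integrableOn_tri_of_sliceNorm_le {T C : ℝ} {f : ℝ → ℝ → E}
    (hf : Measurable fun p : ℝ × ℝ => f p.1 p.2)
    (h : ∀ᵐ t ∂(volume.restrict (Ioo 0 T)), sliceNorm f T t ≤ ENNReal.ofReal C) :
    IntegrableOn (fun p : ℝ × ℝ => ‖f p.1 p.2‖ ^ 2) (tri T) := by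
  rw [integrableOn_tri_iff T hf]
  calc ∫⁻ t in Ioo 0 T, sliceNorm f T t ^ 2
      ≤ ∫⁻ _ in Ioo 0 T, ENNReal.ofReal C ^ 2 :=
        lintegral_mono_ae (h.mono fun t ht => by gcongr)
    _ < ∞ := by
        rw [setLIntegral_const]
        exact ENNReal.mul_lt_top (by simp) (by simp)

variable [SecondCountableTopology E]

theorem aestronglyMeasurable_slice {f : ℝ → ℝ → E}
    (hf : Measurable fun p : ℝ × ℝ => f p.1 p.2) (t : ℝ) (μ : Measure ℝ) :
    AEStronglyMeasurable (fun s => f s t) μ :=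
  (hf.comp (measurable_id.prodMk measurable_const)).aestronglyMeasurable

theorem sliceNorm_add_le {f g : ℝ → ℝ → E} (hf : Measurable fun p : ℝ × ℝ => f p.1 p.2)
    (hg : Measurable fun p : ℝ × ℝ => g p.1 p.2) (b t : ℝ) :
    sliceNorm (fun s t => f s t + g s t) b t ≤ sliceNorm f b t + sliceNorm g b t :=
  eLpNorm_add_le (aestronglyMeasurable_slice hf t _) (aestronglyMeasurable_slice hg t _)
    one_le_two

theorem sqrt_integral_slice {f : ℝ → ℝ → E} (hf : Measurable fun p : ℝ × ℝ => f p.1 p.2)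
    (b t : ℝ) : Real.sqrt (∫ s in Ioo t b, ‖f s t‖ ^ 2) = (sliceNorm f b t).toReal := by
  rw [integral_eq_lintegral_of_nonneg_ae (Eventually.of_forall fun s => sq_nonneg _)
    ((aestronglyMeasurable_slice hf t _).norm.pow 2)]
  simp_rw [ENNReal.ofReal_pow (norm_nonneg _), ofReal_norm]
  rw [← sliceNorm_sq, ENNReal.toReal_pow, Real.sqrt_sq ENNReal.toReal_nonneg]

/-- A pointwise limit of measurable functions can be chosen measurably, wherever it exists. -/
theorem exists_measurable_pointwise_limit [CompleteSpace E] {F : ℕ → ℝ → ℝ → E}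
    (hF : ∀ n, Measurable fun p : ℝ × ℝ => F n p.1 p.2) :
    ∃ f : ℝ → ℝ → E, (Measurable fun p : ℝ × ℝ => f p.1 p.2) ∧
      ∀ s t, (∃ l, Tendsto (fun n => F n s t) atTop (𝓝 l)) →
        Tendsto (fun n => F n s t) atTop (𝓝 (f s t)) :=
  ⟨fun s t => limUnder atTop fun n => F n s t,
    (StronglyMeasurable.limUnder fun n => (hF n).stronglyMeasurable).measurable,
    fun _ _ => tendsto_nhds_limUnder⟩

end

/-- The Borel structure for the topology induced by the Frobenius norm. -/
instance {d₁ d₂ : ℕ} : @BorelSpace (Matrix (Fin d₁) (Fin d₂) ℝ)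
    PseudoMetricSpace.toUniformSpace.toTopologicalSpace _ :=
  inferInstanceAs (BorelSpace (Fin d₁ → Fin d₂ → ℝ))

instance {d₁ d₂ : ℕ} : @SecondCountableTopology (Matrix (Fin d₁) (Fin d₂) ℝ)
    PseudoMetricSpace.toUniformSpace.toTopologicalSpace :=
  inferInstanceAs (SecondCountableTopology (Fin d₁ → Fin d₂ → ℝ))

/-- Any interval can be partitioned so that finitely many given points are not interior to
any piece. -/
theorem exists_partition_avoiding (A : Finset ℝ) {a b : ℝ} (hab : a < b) :
    ∃ (m : ℕ) (U : ℕ → ℝ), U 0 = a ∧ U m = b ∧ (∀ i < m, U i < U (i + 1)) ∧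
      ∀ i < m, ∀ x ∈ A, x ∉ Ioo (U i) (U (i + 1)) := by
  induction hn : (A.filter (· ∈ Ioo a b)).card using Nat.strong_induction_on generalizing a with
  | _ n ih =>
  rcases (A.filter (· ∈ Ioo a b)).eq_empty_or_nonempty with h | h
  · refine ⟨1, fun i => if i = 0 then a else b, by simp, by simp, by simpa using hab, ?_⟩
    intro i hi x hx hxI
    obtain rfl : i = 0 := by omega
    exact Finset.notMem_empty x (h ▸ Finset.mem_filter.2 ⟨hx, by simpa using hxI⟩)
  · set c := (A.filter (· ∈ Ioo a b)).min' h with hc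
    have hcA := Finset.min'_mem _ h
    rw [← hc, Finset.mem_filter] at hcA
    obtain ⟨hcA, hac, hcb⟩ := hcA
    have hlt : (A.filter (· ∈ Ioo c b)).card < n := by
      rw [← hn]
      refine Finset.card_lt_card (Finset.ssubset_iff_of_subset ?_ |>.2
        ⟨c, Finset.mem_filter.2 ⟨hcA, hac, hcb⟩, by simp⟩)
      intro x hx
      rw [Finset.mem_filter] at hx ⊢
      exact ⟨hx.1, hac.trans hx.2.1, hx.2.2⟩
    obtain ⟨m, U, hU0, hUm, hU, hUA⟩ := ih _ hlt hcb rfl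
    refine ⟨m + 1, fun i => Nat.casesOn i a U, rfl, hUm, ?_, ?_⟩
    · rintro (_ | i) hi
      · simpa [hU0] using hac
      · exact hU i (by omega)
    · rintro (_ | i) hi x hx hxI
      · simp only [hU0] at hxI
        have := Finset.min'_le (A.filter (· ∈ Ioo a b)) x
          (Finset.mem_filter.2 ⟨hx, hxI.1, hxI.2.trans hcb⟩)
        exact absurd hxI.2 (not_lt.2 this)
      · exact hUA i (by omega) x hx hxI

/-- A piece of a partition containing a given interval. -/
theorem exists_subinterval_of_partition {m : ℕ} {U : ℕ → ℝ} {a b : ℝ}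
    (ha : U 0 ≤ a) (hb : b ≤ U m) (hab : a < b) (h : ∀ i ≤ m, U i ∉ Ioo a b) :
    ∃ i < m, U i ≤ a ∧ b ≤ U (i + 1) := by
  classical
  have hex : ∃ j, b ≤ U j := ⟨m, hb⟩
  have h0 : Nat.find hex ≠ 0 := fun h0 => by
    have := Nat.find_spec hex
    rw [h0] at this
    linarith
  obtain ⟨i, hi⟩ := Nat.exists_eq_succ_of_ne_zero h0
  have him : i < m := by
    have := Nat.find_min' hex hb
    omega
  refine ⟨i, him, ?_, by simpa [hi] using Nat.find_spec hex⟩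
  have hib : U i < b := not_le.1 (Nat.find_min hex (by omega))
  by_contra! hai
  exact h i him.le ⟨hai, hib⟩

/-- Uniform smallness of the slices `s ↦ f s t`, `t < s < b`, over all intervals `(a, b)`
that avoid a suitable finite set. This reformulates the partition property of `MemSL2`. -/
def SmallOffFinset {E : Type*} [NormedAddCommGroup E] (T : ℝ) (f : ℝ → ℝ → E) : Prop :=
  ∀ ε > 0, ∃ A : Finset ℝ, ∀ a b, 0 ≤ a → a < b → b ≤ T → (∀ x ∈ A, x ∉ Ioo a b) →
    ∀ᵐ t ∂(volume.restrict (Ioo a b)), sliceNorm f b t ≤ ENNReal.ofReal ε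

theorem le_of_partition {T : ℝ} {m : ℕ} {U : ℕ → ℝ} (h0 : U 0 = 0) (hm : U m = T)
    (hU : ∀ i < m, U i < U (i + 1)) {i : ℕ} (hi : i ≤ m) : 0 ≤ U i ∧ U i ≤ T := by
  have hmono : ∀ j k, j ≤ k → k ≤ m → U j ≤ U k := fun j k hjk => by
    induction k, hjk using Nat.le_induction with
    | base => exact fun _ => le_rfl
    | succ k _ ih => exact fun hk => (ih (by omega)).trans (hU k (by omega)).le
  exact ⟨h0 ▸ hmono 0 i (by omega) hi, hm ▸ hmono i m hi le_rfl⟩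

instance {d₁ d₂ : ℕ} : MeasurableAdd₂ (Matrix (Fin d₁) (Fin d₂) ℝ) :=
  inferInstanceAs (MeasurableAdd₂ (Fin d₁ → Fin d₂ → ℝ))

instance {d₁ d₂ : ℕ} : MeasurableSub₂ (Matrix (Fin d₁) (Fin d₂) ℝ) :=
  inferInstanceAs (MeasurableSub₂ (Fin d₁ → Fin d₂ → ℝ))

instance {d₁ d₂ : ℕ} : MeasurableConstSMul ℝ (Matrix (Fin d₁) (Fin d₂) ℝ) :=
  inferInstanceAs (MeasurableConstSMul ℝ (Fin d₁ → Fin d₂ → ℝ))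

section
variable {d₁ d₂ : ℕ} {T : ℝ} {f g : ℝ → ℝ → Matrix (Fin d₁) (Fin d₂) ℝ}

theorem memSL2_iff (hT : 0 < T) : MemSL2 T f ↔
    (Measurable fun p : ℝ × ℝ => f p.1 p.2) ∧
    (∃ C : ℝ, ∀ᵐ t ∂(volume.restrict (Ioo 0 T)), sliceNorm f T t ≤ ENNReal.ofReal C) ∧
    SmallOffFinset T f := by
  constructor
  · rintro ⟨hf, hint, ⟨C, hC⟩, hpart⟩
    have hfin := ae_sliceNorm_lt_top hf hint
    refine ⟨hf, ⟨C, ?_⟩, fun ε hε => ?_⟩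
    · filter_upwards [hC, hfin] with t h₁ h₂
      rw [sqrt_integral_slice hf] at h₁
      exact ENNReal.le_ofReal_iff_toReal_le h₂.ne (ENNReal.toReal_nonneg.trans h₁) |>.2 h₁
    · obtain ⟨m, U, hU0, hUm, hU, hc⟩ := hpart ε hε
      refine ⟨(Finset.range (m + 1)).image U, fun a b ha hab hb hA => ?_⟩
      obtain ⟨i, him, hia, hib⟩ := exists_subinterval_of_partition (hU0.trans_le ha) (hb.trans_eq hUm.symm) hab
        fun i hi => hA _ (Finset.mem_image_of_mem U (Finset.mem_range.2 (by omega)))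
      obtain ⟨c, hcε, hc⟩ := hc i him
      have hc' := ae_restrict_of_ae_restrict_of_subset (Ioo_subset_Ioo hia hib) hc
      have hfin' := ae_restrict_of_ae_restrict_of_subset (Ioo_subset_Ioo ha hb) hfin
      filter_upwards [hc', hfin'] with t h₁ h₂
      rw [sqrt_integral_slice hf] at h₁
      have hUT := (le_of_partition hU0 hUm hU (Nat.succ_le_of_lt him)).2
      have h₃ := (sliceNorm_mono f hUT t).trans_lt h₂
      refine (sliceNorm_mono f hib t).trans ?_
      exact (ENNReal.le_ofReal_iff_toReal_le h₃.ne hε.le).2 (h₁.trans hcε.le)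
  · rintro ⟨hf, ⟨C, hC⟩, hsmall⟩
    refine ⟨hf, integrableOn_tri_of_sliceNorm_le hf hC, ⟨max C 0, ?_⟩, fun ε hε => ?_⟩
    · filter_upwards [hC] with t ht
      rw [sqrt_integral_slice hf]
      exact ENNReal.toReal_le_of_le_ofReal (le_max_right _ _)
        (ht.trans (ENNReal.ofReal_le_ofReal (le_max_left _ _)))
    · obtain ⟨A, hA⟩ := hsmall (ε / 2) (half_pos hε)
      obtain ⟨m, U, hU0, hUm, hU, hUA⟩ := exists_partition_avoiding A hT
      refine ⟨m, U, hU0, hUm, hU, fun i hi => ⟨ε / 2, half_lt_self hε, ?_⟩⟩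
      filter_upwards [hA _ _ (le_of_partition hU0 hUm hU hi.le).1 (hU i hi)
        (le_of_partition hU0 hUm hU (Nat.succ_le_of_lt hi)).2 (hUA i hi)] with t ht
      rw [sqrt_integral_slice hf]
      exact ENNReal.toReal_le_of_le_ofReal (half_pos hε).le ht

theorem sl2norm_le_iff (hT : 0 < T) (hf : MemSL2 T f) {C : ℝ} :
    sl2norm T f ≤ C ↔
      0 ≤ C ∧ ∀ᵐ t ∂(volume.restrict (Ioo 0 T)), sliceNorm f T t ≤ ENNReal.ofReal C := by
  have hfin := ae_sliceNorm_lt_top hf.1 hf.2.1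
  have : NeBot (ae (volume.restrict (Ioo 0 T))) := by
    rw [ae_neBot, Ne, Measure.restrict_eq_zero]
    simp [hT]
  obtain ⟨-, -, ⟨B, hB⟩, -⟩ := id hf
  have hle : ∀ᵐ t ∂(volume.restrict (Ioo 0 T)),
      Real.sqrt (∫ s in Ioo t T, ‖f s t‖ ^ 2) ≤ sl2norm T f :=
    ae_le_essSup ⟨B, hB⟩
  constructor
  · intro h
    have h0 : 0 ≤ C := by
      obtain ⟨t, ht⟩ := hle.exists
      exact (Real.sqrt_nonneg _).trans (ht.trans h)
    refine ⟨h0, ?_⟩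
    filter_upwards [hle, hfin] with t h₁ h₂
    rw [sqrt_integral_slice hf.1] at h₁
    exact (ENNReal.le_ofReal_iff_toReal_le h₂.ne h0).2 (h₁.trans h)
  · rintro ⟨h0, h⟩
    refine essSup_le_of_ae_le C ?_ ?_
    · filter_upwards [h] with t ht
      rw [sqrt_integral_slice hf.1]
      exact ENNReal.toReal_le_of_le_ofReal h0 ht
    · exact IsBoundedUnder.isCoboundedUnder_le
        (isBoundedUnder_of ⟨0, fun t => Real.sqrt_nonneg _⟩)

theorem MemSL2.sl2norm_nonneg (hT : 0 < T) (hf : MemSL2 T f) : 0 ≤ sl2norm T f :=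
  ((sl2norm_le_iff hT hf).1 le_rfl).1

theorem MemSL2.sliceNorm_le (hT : 0 < T) (hf : MemSL2 T f) :
    ∀ᵐ t ∂(volume.restrict (Ioo 0 T)), sliceNorm f T t ≤ ENNReal.ofReal (sl2norm T f) :=
  ((sl2norm_le_iff hT hf).1 le_rfl).2

theorem MemSL2.add (hT : 0 < T) (hf : MemSL2 T f) (hg : MemSL2 T g) :
    MemSL2 T (fun s t => f s t + g s t) := by
  obtain ⟨hfm, -, hfs⟩ := (memSL2_iff hT).1 hf
  obtain ⟨hgm, -, hgs⟩ := (memSL2_iff hT).1 hg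
  refine (memSL2_iff hT).2 ⟨hfm.add hgm, ⟨sl2norm T f + sl2norm T g, ?_⟩, fun ε hε => ?_⟩
  · filter_upwards [hf.sliceNorm_le hT, hg.sliceNorm_le hT] with t h₁ h₂
    rw [ENNReal.ofReal_add (hf.sl2norm_nonneg hT) (hg.sl2norm_nonneg hT)]
    exact (sliceNorm_add_le hfm hgm T t).trans (add_le_add h₁ h₂)
  · classical
    obtain ⟨A, hA⟩ := hfs (ε / 2) (half_pos hε)
    obtain ⟨B, hB⟩ := hgs (ε / 2) (half_pos hε)
    refine ⟨A ∪ B, fun a b ha hab hb hAB => ?_⟩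
    filter_upwards [hA a b ha hab hb fun x hx => hAB x (Finset.mem_union_left _ hx),
      hB a b ha hab hb fun x hx => hAB x (Finset.mem_union_right _ hx)] with t h₁ h₂
    rw [← add_halves ε, ENNReal.ofReal_add (half_pos hε).le (half_pos hε).le]
    exact (sliceNorm_add_le hfm hgm b t).trans (add_le_add h₁ h₂)

theorem MemSL2.const_smul (hT : 0 < T) (hf : MemSL2 T f) (c : ℝ) :
    MemSL2 T (fun s t => c • f s t) := by
  obtain ⟨hfm, ⟨C, hC⟩, hfs⟩ := (memSL2_iff hT).1 hf
  refine (memSL2_iff hT).2 ⟨hfm.const_smul c, ⟨|c| * C, ?_⟩, fun ε hε => ?_⟩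
  · filter_upwards [hC] with t ht
    rw [sliceNorm_const_smul, ENNReal.ofReal_mul (abs_nonneg c), ← Real.norm_eq_abs, ofReal_norm]
    gcongr
  · obtain ⟨A, hA⟩ := hfs (ε / (|c| + 1)) (by positivity)
    refine ⟨A, fun a b ha hab hb hAB => ?_⟩
    filter_upwards [hA a b ha hab hb hAB] with t ht
    rw [sliceNorm_const_smul, ← ofReal_norm, Real.norm_eq_abs]
    calc ENNReal.ofReal |c| * sliceNorm f b t
        ≤ ENNReal.ofReal |c| * ENNReal.ofReal (ε / (|c| + 1)) := by gcongr
      _ = ENNReal.ofReal (|c| * (ε / (|c| + 1))) := (ENNReal.ofReal_mul (abs_nonneg c)).symm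
      _ ≤ ENNReal.ofReal ε := by
        refine ENNReal.ofReal_le_ofReal ?_
        rw [mul_div_assoc', div_le_iff₀ (by positivity)]
        nlinarith [abs_nonneg c]

theorem MemSL2.sub (hT : 0 < T) (hf : MemSL2 T f) (hg : MemSL2 T g) :
    MemSL2 T (fun s t => f s t - g s t) := by
  simpa [sub_eq_add_neg] using hf.add hT (hg.const_smul hT (-1))

theorem MemSL2.sl2norm_add_le (hT : 0 < T) (hf : MemSL2 T f) (hg : MemSL2 T g) :
    sl2norm T (fun s t => f s t + g s t) ≤ sl2norm T f + sl2norm T g := by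
  have hf0 := hf.sl2norm_nonneg hT
  have hg0 := hg.sl2norm_nonneg hT
  refine (sl2norm_le_iff hT (hf.add hT hg)).2 ⟨add_nonneg hf0 hg0, ?_⟩
  filter_upwards [hf.sliceNorm_le hT, hg.sliceNorm_le hT] with t h₁ h₂
  rw [ENNReal.ofReal_add hf0 hg0]
  exact (sliceNorm_add_le hf.1 hg.1 T t).trans (add_le_add h₁ h₂)

theorem MemSL2.sl2norm_const_smul_le (hT : 0 < T) (hf : MemSL2 T f) (c : ℝ) :
    sl2norm T (fun s t => c • f s t) ≤ |c| * sl2norm T f := by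
  refine (sl2norm_le_iff hT (hf.const_smul hT c)).2
    ⟨mul_nonneg (abs_nonneg c) (hf.sl2norm_nonneg hT), ?_⟩
  filter_upwards [hf.sliceNorm_le hT] with t ht
  rw [sliceNorm_const_smul, ENNReal.ofReal_mul (abs_nonneg c), ← Real.norm_eq_abs, ofReal_norm]
  gcongr

theorem MemSL2.sl2norm_const_smul (hT : 0 < T) (hf : MemSL2 T f) (c : ℝ) :
    sl2norm T (fun s t => c • f s t) = |c| * sl2norm T f := by
  refine (hf.sl2norm_const_smul_le hT c).antisymm ?_
  rcases eq_or_ne c 0 with rfl | hc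
  · simpa using (hf.const_smul hT 0).sl2norm_nonneg hT
  · have h := (hf.const_smul hT c).sl2norm_const_smul_le hT c⁻¹
    simp only [inv_smul_smul₀ hc, abs_inv] at h
    rwa [← div_eq_inv_mul, le_div_iff₀' (abs_pos.2 hc)] at h

theorem MemSL2.sl2norm_eq_zero_iff (hT : 0 < T) (hf : MemSL2 T f) :
    sl2norm T f = 0 ↔ ∀ᵐ p ∂(volume.restrict (tri T)), f p.1 p.2 = 0 := by
  rw [ae_tri_eq_zero_iff T hf.1, ← (hf.sl2norm_nonneg hT).ge_iff_eq', sl2norm_le_iff hT hf]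
  simp

/-- The space `sL²` is closed under uniform approximation in the slice norms. -/
theorem memSL2_of_forall_approx (hT : 0 < T) (hf : Measurable fun p : ℝ × ℝ => f p.1 p.2)
    (h : ∀ ε > 0, ∃ g, MemSL2 T g ∧ ∀ᵐ t ∂(volume.restrict (Ioo 0 T)),
      sliceNorm (fun s t => f s t - g s t) T t ≤ ENNReal.ofReal ε) :
    MemSL2 T f := by
  have key : ∀ {g : ℝ → ℝ → Matrix (Fin d₁) (Fin d₂) ℝ}, MemSL2 T g → ∀ b t,
      sliceNorm f b t ≤ sliceNorm g b t + sliceNorm (fun s t => f s t - g s t) b t := by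
    intro g hg b t
    simpa using sliceNorm_add_le (g := fun s t => f s t - g s t) hg.1 (hf.sub hg.1) b t
  refine (memSL2_iff hT).2 ⟨hf, ?_, fun ε hε => ?_⟩
  · obtain ⟨g, hg, hfg⟩ := h 1 one_pos
    refine ⟨sl2norm T g + 1, ?_⟩
    filter_upwards [hg.sliceNorm_le hT, hfg] with t h₁ h₂
    rw [ENNReal.ofReal_add (hg.sl2norm_nonneg hT) one_pos.le]
    exact (key hg T t).trans (add_le_add h₁ h₂)
  · obtain ⟨g, hg, hfg⟩ := h (ε / 2) (half_pos hε)
    obtain ⟨A, hA⟩ := ((memSL2_iff hT).1 hg).2.2 (ε / 2) (half_pos hε)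
    refine ⟨A, fun a b ha hab hb hAB => ?_⟩
    filter_upwards [hA a b ha hab hb hAB,
      ae_restrict_of_ae_restrict_of_subset (Ioo_subset_Ioo ha hb) hfg] with t h₁ h₂
    rw [← add_halves ε, ENNReal.ofReal_add (half_pos hε).le (half_pos hε).le]
    exact (key hg b t).trans (add_le_add h₁ ((sliceNorm_mono _ hb t).trans h₂))

theorem exists_sl2_limit (hT : 0 < T) {F : ℕ → ℝ → ℝ → Matrix (Fin d₁) (Fin d₂) ℝ}
    (hF : ∀ n, MemSL2 T (F n))
    (hcau : ∀ ε > 0, ∃ N, ∀ m ≥ N, ∀ n ≥ N, sl2norm T (fun s t => F m s t - F n s t) < ε) :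
    ∃ f, MemSL2 T f ∧ Tendsto (fun n => sl2norm T (fun s t => F n s t - f s t)) atTop (𝓝 0) := by
  have hd : ∀ m n, ∀ᵐ t ∂(volume.restrict (Ioo 0 T)),
      sliceNorm (fun s t => F m s t - F n s t) T t ≤
        ENNReal.ofReal (sl2norm T fun s t => F m s t - F n s t) :=
    fun m n => ((hF m).sub hT (hF n)).sliceNorm_le hT
  choose! N hN using hcau
  have hpos : ∀ k : ℕ, (0 : ℝ) < (1 / 2) ^ k := fun k => by positivity
  obtain ⟨φ, hφ, hφN⟩ : ∃ φ : ℕ → ℕ, StrictMono φ ∧ ∀ k, N ((1 / 2) ^ k) ≤ φ k :=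
    extraction_forall_of_eventually' fun k => eventually_ge_atTop _ |>.exists_forall_of_atTop
  obtain ⟨f, hfm, hflim⟩ := exists_measurable_pointwise_limit fun k => (hF (φ k)).1
  have hlim : ∀ᵐ t ∂(volume.restrict (Ioo 0 T)), ∀ᵐ s ∂(volume.restrict (Ioo t T)),
      Tendsto (fun k => F (φ k) s t) atTop (𝓝 (f s t)) := by
    filter_upwards [ae_all_iff.2 fun m => ae_all_iff.2 fun n => hd m n] with t ht
    have hB : ∑' k : ℕ, ENNReal.ofReal ((1 / 2) ^ k) ≠ ∞ :=
      (summable_geometric_two.tsum_ofReal_ne_top)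
    have := Lp.ae_tendsto_of_cauchy_eLpNorm (p := 2) (μ := volume.restrict (Ioo t T))
      (f := fun k s => F (φ k) s t) (fun k => aestronglyMeasurable_slice (hF _).1 t _)
      one_le_two hB fun k m n hm hn => (ht (φ m) (φ n)).trans_lt
        ((ENNReal.ofReal_lt_ofReal_iff (hpos k)).2 (hN _ (hpos k) _
          ((hφN k).trans (hφ.monotone hm)) _ ((hφN k).trans (hφ.monotone hn))))
    exact this.mono fun s hs => hflim s t hs
  have happrox : ∀ ε > 0, ∀ n ≥ N ε, ∀ᵐ t ∂(volume.restrict (Ioo 0 T)),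
      sliceNorm (fun s t => f s t - F n s t) T t ≤ ENNReal.ofReal ε := by
    intro ε hε n hn
    filter_upwards [hlim, ae_all_iff.2 fun m => hd m n] with t ht hdt
    refine (Lp.eLpNorm_lim_le_liminf_eLpNorm (f := fun k s => F (φ k) s t - F n s t)
      (fun k => aestronglyMeasurable_slice
        (f := fun s t => F (φ k) s t - F n s t) ((hF _).sub hT (hF n)).1 t _) _
      (ht.mono fun s hs => hs.sub_const _)).trans ?_
    refine liminf_le_of_frequently_le' (Eventually.frequently ?_)
    filter_upwards [hφ.tendsto_atTop.eventually_ge_atTop (N ε)] with k hk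
    exact (hdt (φ k)).trans (ENNReal.ofReal_le_ofReal (hN ε hε _ hk _ hn).le)
  have hf : MemSL2 T f := memSL2_of_forall_approx hT hfm fun ε hε =>
    ⟨F (N ε), hF _, happrox ε hε _ le_rfl⟩
  refine ⟨f, hf, Metric.tendsto_atTop.2 fun ε hε => ⟨N (ε / 2), fun n hn => ?_⟩⟩
  have hsub := (hF n).sub hT hf
  rw [Real.dist_0_eq_abs, abs_of_nonneg (hsub.sl2norm_nonneg hT)]
  refine lt_of_le_of_lt ((sl2norm_le_iff hT hsub).2 ⟨(half_pos hε).le, ?_⟩) (half_lt_self hε)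
  filter_upwards [happrox _ (half_pos hε) n hn] with t ht
  have := sliceNorm_const_smul (-1) (fun s t => f s t - F n s t) T t
  simp only [neg_smul, one_smul, neg_sub, enorm_neg, enorm_one, one_mul] at this
  rwa [this]

end

/-- **`sL²(△₂(0,T); ℝ^{d₁×d₂})` is a Banach space** (with functions identified when equal
a.e.): it is closed under addition and scalar multiplication (hence a linear subspace of
`L²(△₂(0,T))`, square integrability being part of the membership), `‖·‖_{sL²}` is a norm on
it, and every Cauchy sequence converges to an element of `sL²`. -/
theorem sL2_is_banach (T : ℝ) (hT : 0 < T) (d₁ d₂ : ℕ) :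
    -- closed under addition
    (∀ f g : ℝ → ℝ → Matrix (Fin d₁) (Fin d₂) ℝ, MemSL2 T f → MemSL2 T g →
      MemSL2 T (fun s t => f s t + g s t)) ∧
    -- closed under scalar multiplication
    (∀ (f : ℝ → ℝ → Matrix (Fin d₁) (Fin d₂) ℝ) (c : ℝ), MemSL2 T f →
      MemSL2 T (fun s t => c • f s t)) ∧
    -- nonnegativity
    (∀ f : ℝ → ℝ → Matrix (Fin d₁) (Fin d₂) ℝ, MemSL2 T f → 0 ≤ sl2norm T f) ∧
    -- triangle inequality
    (∀ f g : ℝ → ℝ → Matrix (Fin d₁) (Fin d₂) ℝ, MemSL2 T f → MemSL2 T g →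
      sl2norm T (fun s t => f s t + g s t) ≤ sl2norm T f + sl2norm T g) ∧
    -- absolute homogeneity
    (∀ (f : ℝ → ℝ → Matrix (Fin d₁) (Fin d₂) ℝ) (c : ℝ), MemSL2 T f →
      sl2norm T (fun s t => c • f s t) = |c| * sl2norm T f) ∧
    -- separation: zero norm iff zero a.e. on the triangle
    (∀ f : ℝ → ℝ → Matrix (Fin d₁) (Fin d₂) ℝ, MemSL2 T f →
      (sl2norm T f = 0 ↔ ∀ᵐ p ∂(volume.restrict (tri T)), f p.1 p.2 = 0)) ∧
    -- completeness
    (∀ F : ℕ → ℝ → ℝ → Matrix (Fin d₁) (Fin d₂) ℝ, (∀ n, MemSL2 T (F n)) →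
      (∀ ε > 0, ∃ N, ∀ m ≥ N, ∀ n ≥ N,
        sl2norm T (fun s t => F m s t - F n s t) < ε) →
      ∃ f : ℝ → ℝ → Matrix (Fin d₁) (Fin d₂) ℝ, MemSL2 T f ∧
        Filter.Tendsto (fun n => sl2norm T (fun s t => F n s t - f s t))
          Filter.atTop (nhds 0)) := by
  exact ⟨fun _ _ hf hg => hf.add hT hg, fun _ c hf => hf.const_smul hT c,
    fun _ hf => hf.sl2norm_nonneg hT, fun _ _ hf hg => hf.sl2norm_add_le hT hg,
    fun _ c hf => hf.sl2norm_const_smul hT c, fun _ hf => hf.sl2norm_eq_zero_iff hT,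
    fun _ hF hcau => exists_sl2_limit hT hF hcau⟩
end
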